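/- Let Γ be a finite simple graph, C = A(Γ) the associated right-angled Artin group, and H a subgroup of C that is a virtual retract of C. Let Z be the center of H. Then the quotient H / Z is isomorphic to a virtual retract of a right-angled Artin group A(Γ') for some finite simple graph Γ'. -/

import Mathlib

/-- The set of defining relators of the right-angled Artin group on `Γ`. -/
abbrev raagRels {V : Type*} (Γ : SimpleGraph V) : Set (FreeGroup V) :=
  {r | ∃ u v : V, Γ.Adj u v ∧
    r = FreeGroup.of u * FreeGroup.of v * (FreeGroup.of u)⁻¹ * (FreeGroup.of v)⁻¹}

/-- The right-angled Artin group associated to a simple graph `Γ`. -/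
abbrev RAAG {V : Type*} (Γ : SimpleGraph V) := PresentedGroup (raagRels Γ)

/-- A subgroup `H ≤ G` is a virtual retract of `G` if there is a finite-index subgroup
`K` of `G` with `H ≤ K` and a retraction `K →* H` restricting to the identity on `H`. -/
def IsVirtualRetract {G : Type*} [Group G] (H : Subgroup G) : Prop :=
  ∃ (K : Subgroup G) (hK : H ≤ K), K.index ≠ 0 ∧
    ∃ r : K →* H, ∀ h : H, r ⟨(h : G), hK h.2⟩ = h

/-- An integer-valued `0`-hyperbolic metric which is invariant under a group action. -/
structure IsTreeDist (A : Type*) {T : Type*} [Group A] [MulAction A T] (d : T → T → ℤ) :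
    Prop where
  eq_zero_iff : ∀ p q, d p q = 0 ↔ p = q
  symm : ∀ p q, d p q = d q p
  smul : ∀ (a : A) p q, d (a • p) (a • q) = d p q
  four_point : ∀ a b c e, d a b + d c e ≤ max (d a c + d b e) (d a e + d b c)

namespace IsTreeDist

variable {A T : Type*} [Group A] [MulAction A T] {d : T → T → ℤ} {z : A} {o : T} {L : ℤ}

theorem self (hd : IsTreeDist A d) (p : T) : d p p = 0 :=
  (hd.eq_zero_iff p p).2 rfl

theorem triangle (hd : IsTreeDist A d) (p q r : T) : d p r ≤ d p q + d q r := by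
  have := hd.four_point p r q q
  have := hd.self q
  have := hd.symm r q
  omega

theorem nonneg (hd : IsTreeDist A d) (p q : T) : 0 ≤ d p q := by
  have := hd.triangle p q p
  have := hd.self p
  have := hd.symm p q
  omega

theorem dist_zpow_smul (hd : IsTreeDist A d) (hz : ∀ n : ℕ, d o (z ^ n • o) = n * L) (i j : ℤ) :
    d (z ^ i • o) (z ^ j • o) = |i - j| * L := by
  wlog hij : i ≤ j generalizing i j
  · rw [hd.symm, this j i (by omega), abs_sub_comm]
  obtain ⟨n, rfl⟩ := Int.le.dest hij
  rw [zpow_add, mul_smul, hd.smul, zpow_natCast, hz]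
  simp

/-- An element commuting with a translation maps points of the axis to points of the axis. -/
theorem dist_add_dist_of_commute (hd : IsTreeDist A d)
    (hz : ∀ n : ℕ, d o (z ^ n • o) = n * L) {c : A} (hc : Commute c z) {n : ℤ} (hn : 0 ≤ n)
    (hn' : d o (c • o) < n * L) :
    d (z ^ (-n) • o) (c • o) + d (c • o) (z ^ n • o) = 2 * (n * L) := by
  have hcz (k : ℤ) (p : T) : c • z ^ k • p = z ^ k • c • p := by
    rw [smul_smul, smul_smul, (hc.zpow_right k).eq]
  have hP := hd.dist_zpow_smul hz
  have e1 : d (z ^ (-n) • o) (c • z ^ (-n) • o) = d o (c • o) := by rw [hcz, hd.smul]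
  have e2 : d (z ^ n • o) (c • z ^ n • o) = d o (c • o) := by rw [hcz, hd.smul]
  have e3 : d (c • o) (c • z ^ (-n) • o) = n * L := by
    have := hP 0 (-n)
    rw [hd.smul]
    simpa [abs_of_nonneg hn] using this
  have e4 : d (c • o) (c • z ^ n • o) = n * L := by
    have := hP 0 n
    rw [hd.smul]
    simpa [abs_of_nonneg hn] using this
  have e5 : d (c • z ^ (-n) • o) (c • z ^ n • o) = 2 * (n * L) := by
    rw [hd.smul, hP, abs_sub_comm, sub_neg_eq_add, abs_of_nonneg (by omega)]; ring
  have e6 : d (z ^ (-n) • o) (z ^ n • o) = 2 * (n * L) := by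
    rw [hP, abs_sub_comm, sub_neg_eq_add, abs_of_nonneg (by omega)]; ring
  generalize z ^ (-n) • o = a at *
  generalize z ^ n • o = b at *
  generalize c • a = q at *
  generalize c • b = q' at *
  generalize c • o = Q at *
  generalize n * L = N at *
  have := hd.four_point q q' b Q
  have := hd.four_point q b a Q
  have := hd.triangle Q a q
  have := hd.triangle Q b q'
  have := hd.triangle a Q b
  have := hd.symm a Q
  have := hd.symm b Q
  have := hd.symm q b
  have := hd.symm q a
  have := hd.symm q' b
  have := hd.symm q' Q
  have := hd.symm q Q
  have := hd.symm a b
  have := hd.symm q q'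
  omega

/-- Translation lengths along the axis of `z` add up. -/
theorem dist_mul_smul (hd : IsTreeDist A d) (hz : ∀ n : ℕ, d o (z ^ n • o) = n * L) {x y : A}
    (hx : Commute x z) (hy : Commute y z) {m : ℤ} (hm : 0 ≤ m)
    (hm' : 2 * d o (x • o) + 2 * d o (y • o) < m * L) :
    d (z ^ (-(2 * m)) • o) ((x * y) • o) =
      d (z ^ (-m) • o) (x • o) + d (z ^ (-m) • o) (y • o) := by
  have hxz (k : ℤ) (p : T) : x • z ^ k • p = z ^ k • x • p := by
    rw [smul_smul, smul_smul, (hx.zpow_right k).eq]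
  have hP := hd.dist_zpow_smul hz
  have hx0 := hd.nonneg o (x • o)
  have hy0 := hd.nonneg o (y • o)
  have b1 := hd.dist_add_dist_of_commute hz hx hm (by omega)
  have b2 := hd.dist_add_dist_of_commute hz (hx.mul_left hy) (n := 2 * m) (by omega) (by
    have := hd.triangle o (x • o) ((x * y) • o)
    rw [mul_smul, hd.smul] at this
    rw [mul_smul, mul_assoc]
    omega)
  have e1 : d (z ^ (-(2 * m)) • o) (x • z ^ (-m) • o) = d (z ^ (-m) • o) (x • o) := by
    rw [hxz, show -(2 * m) = -m + -m by ring, zpow_add, mul_smul, hd.smul]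
  have e2 : d (x • z ^ (-m) • o) (z ^ (2 * m) • o) = d (x • o) (z ^ (3 * m) • o) := by
    rw [hxz, show 2 * m = -m + 3 * m by ring, zpow_add, mul_smul, hd.smul]
  have e3 := hd.triangle (x • o) (z ^ m • o) (z ^ (3 * m) • o)
  rw [hP, abs_sub_comm, show 3 * m - m = 2 * m by ring, abs_of_nonneg (by omega),
    mul_assoc] at e3
  have e4 : d (x • z ^ (-m) • o) ((x * y) • o) = d (z ^ (-m) • o) (y • o) := by
    rw [mul_smul, hd.smul]
  have e5 : d (z ^ (-(2 * m)) • o) (z ^ (2 * m) • o) = 2 * (2 * m * L) := by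
    rw [hP, abs_sub_comm, sub_neg_eq_add, abs_of_nonneg (by omega)]; ring
  have e6 : d (z ^ (-m) • o) o = m * L := by
    have := hP (-m) 0
    simpa [abs_of_nonneg hm] using this
  have e7 : d (z ^ (-(2 * m)) • o) o = 2 * (m * L) := by
    have := hP (-(2 * m)) 0
    rw [sub_zero, abs_neg, abs_of_nonneg (by omega), mul_assoc] at this
    simpa using this
  have e8 := hd.triangle (z ^ (-m) • o) o (x • o)
  have e9 := hd.triangle (z ^ (-m) • o) o (y • o)
  have e10 := hd.triangle (z ^ (-m) • o) (y • o) o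
  have e11 := hd.triangle (z ^ (-(2 * m)) • o) ((x * y) • o) o
  have e12 : d ((x * y) • o) o ≤ d o (x • o) + d o (y • o) := by
    have := hd.triangle o (x • o) ((x * y) • o)
    rwa [mul_smul, hd.smul, ← mul_smul, hd.symm o ((x * y) • o)] at this
  rw [mul_assoc] at b2 e5
  rw [hd.symm (y • o) o] at e10
  generalize (x * y) • o = W at *
  generalize x • z ^ (-m) • o = U at *
  generalize z ^ (-(2 * m)) • o = a at *
  generalize z ^ (2 * m) • o = b at *
  generalize m * L = N at *
  have := hd.four_point a b U W
  have := hd.triangle a U W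
  have := hd.symm b W
  have := hd.symm b U
  omega

/-- The centralizer of a translation acts on its axis through an abelian group. -/
theorem mul_smul_eq_of_commute (hd : IsTreeDist A d) (hL : 0 < L)
    (hz : ∀ n : ℕ, d o (z ^ n • o) = n * L) {x y : A} (hx : Commute x z) (hy : Commute y z) :
    (x * y) • o = (y * x) • o := by
  have hx0 := hd.nonneg o (x • o)
  have hy0 := hd.nonneg o (y • o)
  obtain ⟨m, hm⟩ : ∃ m : ℤ, m = 2 * d o (x • o) + 2 * d o (y • o) + 1 := ⟨_, rfl⟩
  have hmL : m ≤ m * L := le_mul_of_one_le_right (by omega) hL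
  have h1 := hd.dist_mul_smul hz hx hy (m := m) (by omega) (by omega)
  have h2 := hd.dist_mul_smul hz hy hx (m := m) (by omega) (by omega)
  have h3 : d o ((x * y) • o) < 2 * m * L := by
    have := hd.triangle o (x • o) ((x * y) • o)
    rw [mul_smul, hd.smul] at this
    rw [mul_smul, mul_assoc]
    omega
  have h4 : d o ((y * x) • o) < 2 * m * L := by
    have := hd.triangle o (y • o) ((y * x) • o)
    rw [mul_smul, hd.smul] at this
    rw [mul_smul, mul_assoc]
    omega
  have b1 := hd.dist_add_dist_of_commute hz (hx.mul_left hy) (n := 2 * m) (by omega) h3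
  have b2 := hd.dist_add_dist_of_commute hz (hy.mul_left hx) (n := 2 * m) (by omega) h4
  have e5 : d (z ^ (-(2 * m)) • o) (z ^ (2 * m) • o) = 2 * (2 * m * L) := by
    rw [hd.dist_zpow_smul hz, abs_sub_comm, sub_neg_eq_add, abs_of_nonneg (by omega)]; ring
  rw [← hd.eq_zero_iff]
  generalize (x * y) • o = W at *
  generalize (y * x) • o = W' at *
  generalize z ^ (-(2 * m)) • o = a at *
  generalize z ^ (2 * m) • o = b at *
  have := hd.four_point a b W W'
  have := hd.nonneg W W'
  have := hd.symm b W
  have := hd.symm b W'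
  omega

/-- A local-to-global principle for translations. -/
theorem dist_pow_smul (hd : IsTreeDist A d) (hL : 0 < L) (h1 : d o (z • o) = L)
    (h2 : d o (z ^ 2 • o) = 2 * L) (n : ℕ) : d o (z ^ n • o) = n * L := by
  induction n using Nat.strong_induction_on with
  | _ n ih =>
    match n with
    | 0 => simp [hd.self]
    | 1 => simpa using h1
    | 2 => simpa using h2
    | n + 3 =>
      have i1 := ih (n + 1) (by omega)
      have i2 := ih (n + 2) (by omega)
      have s1 (k : ℕ) : d (z • o) (z ^ (k + 1) • o) = d o (z ^ k • o) := by
        rw [pow_succ', mul_smul, hd.smul]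
      have s2 : d (z ^ (n + 2) • o) (z ^ (n + 3) • o) = L := by
        rw [pow_succ z (n + 2), mul_smul, hd.smul, h1]
      have s3 : d (z • o) (z ^ (n + 2) • o) = d o (z ^ (n + 1) • o) := s1 (n + 1)
      have s4 : d (z • o) (z ^ (n + 3) • o) = d o (z ^ (n + 2) • o) := s1 (n + 2)
      have f := hd.four_point o (z ^ (n + 2) • o) (z • o) (z ^ (n + 3) • o)
      have t := hd.triangle o (z ^ (n + 2) • o) (z ^ (n + 3) • o)
      have := hd.symm (z • o) (z ^ (n + 2) • o)
      push_cast at *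
      have : 0 ≤ n * L := by positivity
      simp only [add_mul] at *
      omega

/-- A displacement-minimizing point is on the axis. -/
theorem dist_pow_smul_of_minimal (hd : IsTreeDist A d) (h1 : d o (z • o) = L) (hL : 1 < L)
    {s : T} (hs : d o s = 1) (hs' : d s (z • o) = L - 1) (hmin : L ≤ d s (z • s)) (n : ℕ) :
    d o (z ^ n • o) = n * L := by
  refine hd.dist_pow_smul (by omega) h1 ?_ n
  rw [pow_two, mul_smul]
  have e1 := hd.smul z o s
  have e2 := hd.smul z s (z • o)
  have e3 := hd.smul z o (z • o)
  generalize z • z • o = P at *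
  generalize z • s = s' at *
  generalize z • o = Q at *
  have := hd.four_point o Q s s'
  have := hd.four_point o s' Q P
  have := hd.triangle o Q P
  have := hd.symm Q s
  have := hd.symm s' Q
  have := hd.four_point o s s' Q
  omega

end IsTreeDist

/-- The length of the longest common prefix of two lists. -/
def commonPrefixLength {β : Type*} [DecidableEq β] : List β → List β → ℕ
  | a :: l, b :: l' => if a = b then commonPrefixLength l l' + 1 else 0
  | _, _ => 0

theorem commonPrefixLength_comm {β : Type*} [DecidableEq β] (l l' : List β) :
    commonPrefixLength l l' = commonPrefixLength l' l := by
  induction l generalizing l' with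
  | nil => cases l' <;> rfl
  | cons a l ih =>
    cases l' with
    | nil => rfl
    | cons b l' => simp only [commonPrefixLength, ih, eq_comm]

theorem min_commonPrefixLength_le {β : Type*} [DecidableEq β] (l₁ l₂ l₃ : List β) :
    min (commonPrefixLength l₁ l₂) (commonPrefixLength l₂ l₃) ≤ commonPrefixLength l₁ l₃ := by
  induction l₁ generalizing l₂ l₃ with
  | nil => cases l₂ <;> simp [commonPrefixLength]
  | cons a l₁ ih =>
    match l₂, l₃ with
    | [], _ => simp [commonPrefixLength]
    | _ :: _, [] => simp [commonPrefixLength]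
    | b :: l₂, c :: l₃ =>
      have := ih l₂ l₃
      simp only [commonPrefixLength]
      split_ifs <;> first | omega | simp_all

namespace FreeGroup

variable {X Y : Type*} [DecidableEq X] [DecidableEq Y]

theorem norm_inv_mul_mk {l l' : List (X × Bool)} (h : IsReduced l) (h' : IsReduced l') :
    ((mk l)⁻¹ * mk l').norm + 2 * commonPrefixLength l l' = l.length + l'.length := by
  induction l generalizing l' with
  | nil =>
    rw [← one_eq_mk, inv_one, one_mul, norm, toWord_mk, h'.reduce_eq]
    simp [commonPrefixLength]
  | cons a l ih =>
    cases l' with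
    | nil =>
      rw [← one_eq_mk, mul_one, norm_inv_eq, norm, toWord_mk, h.reduce_eq]
      simp [commonPrefixLength]
    | cons b l' =>
      by_cases hab : a = b
      · subst hab
        have e (l : List (X × Bool)) : mk (a :: l) = mk [a] * mk l := by simp [mul_mk]
        have := ih (h.infix (List.suffix_cons a l).isInfix)
          (h'.infix (List.suffix_cons a l').isInfix)
        rw [e l, e l', mul_inv_rev, mul_assoc, inv_mul_cancel_left]
        simp only [commonPrefixLength, if_true, List.length_cons]
        omega
      · rw [inv_mk, mul_mk, norm, toWord_mk, IsReduced.reduce_eq]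
        · simp [commonPrefixLength, hab]
        · have hr : IsReduced (invRev (a :: l)) := by
            rw [isReduced_iff_reduce_eq, reduce_invRev, h.reduce_eq]
          rw [IsReduced, List.isChain_append]
          refine ⟨hr, h', ?_⟩
          intro x hx y hy hxy
          have hx' : x = (a.1, !a.2) := by simpa [invRev, eq_comm] using hx
          have hy' : y = b := by simpa [eq_comm] using hy
          subst hx' hy'
          by_contra hne
          exact hab (Prod.ext hxy (by simpa using hne))

theorem toWord_map {f : X → Y} (hf : Function.Injective f) (p : FreeGroup X) :
    (map f p).toWord = p.toWord.map fun x => (f x.1, x.2) := by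
  conv_lhs => rw [← mk_toWord (x := p), map.mk, toWord_mk]
  refine IsReduced.reduce_eq ?_
  have := isReduced_toWord (x := p)
  rw [IsReduced, List.isChain_map]
  exact List.IsChain.imp (fun a b h hab => h (hf hab)) this

theorem norm_map {f : X → Y} (hf : Function.Injective f) (p : FreeGroup X) :
    (map f p).norm = p.norm := by
  rw [norm, toWord_map hf, List.length_map, norm]

/-- An element of a free group fixed by a permutation of the basis is a product of fixed
basis elements. -/
theorem mem_closure_of_map_eq {f : X → X} (hf : Function.Injective f) {p : FreeGroup X}
    (hp : map f p = p) : p ∈ Subgroup.closure (of '' {x | f x = x}) := by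
  have hw := toWord_map hf p
  rw [hp] at hw
  have hfix : ∀ x ∈ p.toWord, f x.1 = x.1 := by
    intro x hx
    have := List.map_eq_map_iff.1 ((List.map_id _).trans hw) x hx
    exact (congrArg Prod.fst this).symm
  rw [← mk_toWord (x := p)]
  generalize p.toWord = w at hfix
  induction w with
  | nil => exact one_mem _
  | cons a w ih =>
    rw [show mk (a :: w) = mk [a] * mk w by simp [mul_mk]]
    refine mul_mem ?_ (ih fun x hx => hfix x (List.mem_cons_of_mem _ hx))
    have ha : of a.1 ∈ Subgroup.closure (of '' {x | f x = x}) :=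
      Subgroup.subset_closure ⟨a.1, hfix a List.mem_cons_self, rfl⟩
    obtain ⟨x, _ | _⟩ := a
    · exact inv_mem ha
    · exact ha

end FreeGroup

section PermAction

variable (G X : Type*) [Group G] [MulAction G X]

/-- The action of `G` on the free group on a `G`-set by permutation of the basis. -/
def permAut : G →* MulAut (FreeGroup X) where
  toFun g := FreeGroup.freeGroupCongr (MulAction.toPerm g)
  map_one' := by
    ext p
    change FreeGroup.map (fun x => (1 : G) • x) p = p
    simp
  map_mul' g h := by
    ext p
    change FreeGroup.map (fun x => (g * h) • x) p =
      FreeGroup.map (fun x => g • x) (FreeGroup.map (fun x => h • x) p)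
    simp [FreeGroup.map.comp, Function.comp_def, mul_smul]

variable {G X}

theorem permAut_apply (g : G) (p : FreeGroup X) :
    permAut G X g p = FreeGroup.map (fun x => g • x) p := rfl

@[simp]
theorem permAut_of (g : G) (x : X) :
    permAut G X g (FreeGroup.of x) = FreeGroup.of (g • x) := rfl

/-- The action of `FreeGroup X ⋊ G` on the Cayley tree of `FreeGroup X`. -/
instance affineAction : MulAction (FreeGroup X ⋊[permAut G X] G) (FreeGroup X) where
  smul a p := a.left * permAut G X a.right p
  one_smul p := by
    change 1 * permAut G X 1 p = p
    simp
  mul_smul a b p := by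
    change (a * b).left * permAut G X (a * b).right p =
      a.left * permAut G X a.right (b.left * permAut G X b.right p)
    simp [mul_assoc]

theorem affine_smul_def (a : FreeGroup X ⋊[permAut G X] G) (p : FreeGroup X) :
    a • p = a.left * permAut G X a.right p := rfl

theorem eq_conj_inr_of_smul_eq {a : FreeGroup X ⋊[permAut G X] G} {p : FreeGroup X}
    (h : a • p = p) :
    a = SemidirectProduct.inl p * SemidirectProduct.inr a.right *
      (SemidirectProduct.inl p)⁻¹ := by
  rw [affine_smul_def, ← eq_mul_inv_iff_mul_eq] at h
  ext
  · rw [h]; simp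
  · simp

/-- The word metric on a free group. -/
def wordDist [DecidableEq X] (p q : FreeGroup X) : ℤ := (p⁻¹ * q).norm

theorem isTreeDist_wordDist [DecidableEq X] :
    IsTreeDist (FreeGroup X ⋊[permAut G X] G) (wordDist (X := X)) where
  eq_zero_iff p q := by
    rw [wordDist, Nat.cast_eq_zero, FreeGroup.norm_eq_zero, inv_mul_eq_one]
  symm p q := by
    rw [wordDist, wordDist, ← FreeGroup.norm_inv_eq, mul_inv_rev, inv_inv]
  smul a p q := by
    rw [wordDist, affine_smul_def, affine_smul_def, mul_inv_rev, mul_assoc, inv_mul_cancel_left,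
      ← map_inv, ← map_mul, permAut_apply, FreeGroup.norm_map (MulAction.injective _), wordDist]
  four_point a b c e := by
    have key (p q : FreeGroup X) : wordDist p q +
        2 * commonPrefixLength (a⁻¹ * p).toWord (a⁻¹ * q).toWord =
          (a⁻¹ * p).norm + (a⁻¹ * q).norm := by
      have := FreeGroup.norm_inv_mul_mk (FreeGroup.isReduced_toWord (x := a⁻¹ * p))
        (FreeGroup.isReduced_toWord (x := a⁻¹ * q))
      rw [FreeGroup.mk_toWord, FreeGroup.mk_toWord, mul_inv_rev, inv_inv, mul_assoc,
        mul_inv_cancel_left] at this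
      rw [wordDist, FreeGroup.norm, FreeGroup.norm, FreeGroup.norm] at *
      exact_mod_cast this
    have h1 := key c e
    have h2 := key b e
    have h3 := key b c
    have h := min_commonPrefixLength_le (a⁻¹ * c).toWord (a⁻¹ * b).toWord (a⁻¹ * e).toWord
    rw [commonPrefixLength_comm (a⁻¹ * c).toWord (a⁻¹ * b).toWord] at h
    have (p : FreeGroup X) : wordDist a p = (a⁻¹ * p).norm := rfl
    rw [this, this, this]
    omega

/-- If `z` has no fixed point on the Cayley tree, then commutators of elements centralizing `z`
have a fixed point. -/
theorem exists_mul_smul_eq_of_commute {x y z : FreeGroup X ⋊[permAut G X] G}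
    (hz : ∀ p : FreeGroup X, z • p ≠ p) (hx : Commute x z) (hy : Commute y z) :
    ∃ p : FreeGroup X, (x * y) • p = (y * x) • p := by
  classical
  have hd := isTreeDist_wordDist (G := G) (X := X)
  let D : FreeGroup X → ℕ := fun p => (wordDist p (z • p)).toNat
  have hD (p : FreeGroup X) : (D p : ℤ) = wordDist p (z • p) := Int.toNat_of_nonneg (hd.nonneg _ _)
  let o := Function.argmin D
  have hmin (p : FreeGroup X) : wordDist o (z • o) ≤ wordDist p (z • p) := by
    rw [← hD, ← hD]
    exact_mod_cast Function.argmin_le D p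
  have hpos : 0 < wordDist o (z • o) := by
    have h0 := hd.nonneg o (z • o)
    have h1 := (hd.eq_zero_iff o (z • o)).not.2 (hz o).symm
    omega
  refine ⟨o, hd.mul_smul_eq_of_commute hpos (fun n => ?_) hx hy⟩
  obtain ⟨a, w, haw⟩ : ∃ a w, (o⁻¹ * (z • o)).toWord = a :: w := by
    refine List.exists_cons_of_ne_nil fun h => ?_
    rw [FreeGroup.toWord_eq_nil_iff, inv_mul_eq_one] at h
    exact hz o h.symm
  have hred := FreeGroup.isReduced_toWord (x := o⁻¹ * (z • o))
  have hzo : z • o = o * (FreeGroup.mk [a] * FreeGroup.mk w) := by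
    rw [FreeGroup.mul_mk, List.singleton_append, ← haw, FreeGroup.mk_toWord, mul_inv_cancel_left]
  have hlen : wordDist o (z • o) = w.length + 1 := by
    rw [wordDist, FreeGroup.norm, haw]; simp
  rw [haw] at hred
  rcases Nat.eq_zero_or_pos w.length with hw | hw
  · refine hd.dist_pow_smul hpos rfl ?_ n
    rw [List.length_eq_zero_iff] at hw
    subst hw
    rw [← FreeGroup.one_eq_mk, mul_one] at hzo
    have h2 : z ^ 2 • o = o * FreeGroup.mk [a, (z.right • a.1, a.2)] := by
      rw [pow_two, mul_smul, hzo, affine_smul_def, map_mul, ← mul_assoc, ← affine_smul_def, hzo,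
        permAut_apply, FreeGroup.map.mk, mul_assoc, FreeGroup.mul_mk]
      rfl
    rw [hlen, h2, wordDist, inv_mul_cancel_left, FreeGroup.norm, FreeGroup.toWord_mk,
      FreeGroup.IsReduced.reduce_eq (by simp)]
    simp
  · refine hd.dist_pow_smul_of_minimal (s := o * FreeGroup.mk [a]) rfl (by omega) ?_ ?_ (hmin _) n
    · rw [wordDist, inv_mul_cancel_left, FreeGroup.norm, FreeGroup.toWord_mk,
        FreeGroup.reduce_singleton]
      simp
    · rw [hlen, hzo, wordDist, mul_inv_rev, mul_assoc, inv_mul_cancel_left, inv_mul_cancel_left,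
        FreeGroup.norm, FreeGroup.toWord_mk,
        (hred.infix (List.suffix_cons a w).isInfix).reduce_eq]
      simp

end PermAction

namespace RAAG

open scoped commutatorElement

variable {V : Type*} {Γ : SimpleGraph V}

/-- The universal property of a right-angled Artin group. -/
def lift {G : Type*} [Group G] (f : V → G) (hf : ∀ u v, Γ.Adj u v → Commute (f u) (f v)) :
    RAAG Γ →* G :=
  PresentedGroup.toGroup (f := f) <| by
    rintro _ ⟨u, v, huv, rfl⟩
    simp [(hf u v huv).eq]

/-- The generator of a right-angled Artin group associated to a vertex. -/
def gen (Γ : SimpleGraph V) (v : V) : RAAG Γ := PresentedGroup.of v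

@[simp]
theorem lift_gen {G : Type*} [Group G] (f : V → G)
    (hf : ∀ u v, Γ.Adj u v → Commute (f u) (f v)) (v : V) : lift f hf (gen Γ v) = f v :=
  PresentedGroup.toGroup.of _

theorem hom_ext {G : Type*} [Group G] {f g : RAAG Γ →* G}
    (h : ∀ v, f (gen Γ v) = g (gen Γ v)) : f = g :=
  PresentedGroup.ext h

theorem commute_gen {u v : V} (h : Γ.Adj u v) : Commute (gen Γ u) (gen Γ v) := by
  have : (PresentedGroup.mk (raagRels Γ)) (FreeGroup.of u * FreeGroup.of v * (FreeGroup.of u)⁻¹ *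
      (FreeGroup.of v)⁻¹) = 1 := PresentedGroup.one_of_mem ⟨u, v, h, rfl⟩
  rw [map_mul, map_mul, map_mul, map_inv, map_inv, mul_inv_eq_one, mul_inv_eq_iff_eq_mul] at this
  exact this

open Classical in
/-- The retraction of a right-angled Artin group killing the vertices outside `S`. -/
noncomputable def retraction (Γ : SimpleGraph V) (S : Set V) : RAAG Γ →* RAAG Γ :=
  lift (fun v => if v ∈ S then gen Γ v else 1) fun u v h => by
    split_ifs
    · exact commute_gen h
    all_goals simp

theorem retraction_gen {S : Set V} {v : V} (hv : v ∈ S) :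
    retraction Γ S (gen Γ v) = gen Γ v := by
  simp [retraction, hv]

theorem retraction_gen_of_notMem {S : Set V} {v : V} (hv : v ∉ S) :
    retraction Γ S (gen Γ v) = 1 := by
  simp [retraction, hv]

theorem retraction_retraction (S T : Set V) (x : RAAG Γ) :
    retraction Γ S (retraction Γ T x) = retraction Γ (S ∩ T) x := by
  refine DFunLike.congr_fun (f := (retraction Γ S).comp (retraction Γ T)) (hom_ext fun v => ?_) x
  by_cases hS : v ∈ S <;> by_cases hT : v ∈ T <;> simp [retraction, hS, hT]

/-- The standard parabolic subgroup generated by a set of vertices. -/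
noncomputable def parabolic (Γ : SimpleGraph V) (S : Set V) : Subgroup (RAAG Γ) :=
  (retraction Γ S).range

theorem retraction_mem (S : Set V) (x : RAAG Γ) : retraction Γ S x ∈ parabolic Γ S := ⟨x, rfl⟩

theorem mem_parabolic_iff {S : Set V} {x : RAAG Γ} :
    x ∈ parabolic Γ S ↔ retraction Γ S x = x := by
  refine ⟨?_, fun h => ⟨x, h⟩⟩
  rintro ⟨y, rfl⟩
  rw [retraction_retraction, Set.inter_self]

theorem gen_mem_parabolic {S : Set V} {v : V} (hv : v ∈ S) : gen Γ v ∈ parabolic Γ S :=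
  mem_parabolic_iff.2 (retraction_gen hv)

theorem parabolic_mono {S T : Set V} (h : S ⊆ T) : parabolic Γ S ≤ parabolic Γ T := by
  intro x hx
  rw [mem_parabolic_iff] at *
  rw [← hx, retraction_retraction, Set.inter_eq_right.2 h]

theorem retraction_mem_inter (S : Set V) {T : Set V} {x : RAAG Γ} (hx : x ∈ parabolic Γ T) :
    retraction Γ S x ∈ parabolic Γ (S ∩ T) := by
  rw [← mem_parabolic_iff.1 hx, retraction_retraction]
  exact retraction_mem _ _

theorem mem_of_forall_gen_mem (K : Subgroup (RAAG Γ)) (h : ∀ v, gen Γ v ∈ K) (x : RAAG Γ) :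
    x ∈ K := by
  have : K = ⊤ := by
    rw [eq_top_iff, ← PresentedGroup.closure_range_of (raagRels Γ), Subgroup.closure_le]
    rintro _ ⟨v, rfl⟩
    exact h v
  rw [this]
  trivial

theorem parabolic_le {S : Set V} {K : Subgroup (RAAG Γ)} (h : ∀ v ∈ S, gen Γ v ∈ K) :
    parabolic Γ S ≤ K := by
  rintro _ ⟨x, rfl⟩
  refine mem_of_forall_gen_mem (K.comap (retraction Γ S)) (fun v => ?_) x
  rw [Subgroup.mem_comap]
  by_cases hv : v ∈ S
  · rw [retraction_gen hv]
    exact h v hv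
  · rw [retraction_gen_of_notMem hv]
    exact one_mem K

theorem parabolic_univ : parabolic Γ Set.univ = ⊤ :=
  eq_top_iff.2 fun x _ =>
    mem_of_forall_gen_mem _ (fun _ => gen_mem_parabolic (Set.mem_univ _)) x

theorem parabolic_empty : parabolic Γ ∅ = ⊥ :=
  eq_bot_iff.2 <| parabolic_le fun _ hv => hv.elim

/-- The set of vertices adjacent to all vertices in `S`. -/
def perp (Γ : SimpleGraph V) (S : Set V) : Set V := {v | ∀ u ∈ S, Γ.Adj u v}

theorem notMem_perp {S : Set V} {v : V} (hv : v ∈ S) : v ∉ perp Γ S := fun h =>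
  Γ.loopless.irrefl v (h v hv)

theorem commute_of_mem_perp {S : Set V} {x y : RAAG Γ} (hx : x ∈ parabolic Γ S)
    (hy : y ∈ parabolic Γ (perp Γ S)) : Commute x y := by
  have h1 : parabolic Γ (perp Γ S) ≤ Subgroup.centralizer (parabolic Γ S) := by
    refine parabolic_le fun v hv => ?_
    rw [Subgroup.mem_centralizer_iff]
    intro g hg
    have : parabolic Γ S ≤ Subgroup.centralizer {gen Γ v} := by
      refine parabolic_le fun u hu => ?_
      rw [Subgroup.mem_centralizer_singleton_iff]
      exact (commute_gen (hv u hu)).eq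
    exact Subgroup.mem_centralizer_singleton_iff.1 (this hg)
  exact h1 hy x hx

/-- The subgroup generated by `S` and `perp Γ S` is a direct product. -/
theorem eq_mul_of_mem_sup {S : Set V} {x : RAAG Γ}
    (hx : x ∈ parabolic Γ S ⊔ parabolic Γ (perp Γ S)) :
    x = retraction Γ S x * retraction Γ (perp Γ S) x := by
  have hdisj : S ∩ perp Γ S = ∅ := Set.eq_empty_of_forall_notMem fun v hv => notMem_perp hv.1 hv.2
  have triv (x : RAAG Γ) : retraction Γ ∅ x = 1 := by
    have := retraction_mem ∅ x
    rwa [parabolic_empty, Subgroup.mem_bot] at this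
  rw [Subgroup.sup_eq_closure] at hx
  induction hx using Subgroup.closure_induction with
  | mem x hx =>
    rcases hx with hx | hx <;>
    · rw [SetLike.mem_coe, mem_parabolic_iff] at hx
      conv_lhs => rw [← hx]
      conv_rhs => rw [← hx]
      simp only [retraction_retraction, Set.inter_self, hdisj, Set.inter_comm _ S, triv, one_mul,
        mul_one]
  | one => simp
  | mul x y _ _ hx hy =>
    have := commute_of_mem_perp (retraction_mem S y) (retraction_mem (perp Γ S) x)
    conv_lhs => rw [hx, hy]
    rw [map_mul, map_mul, mul_assoc, mul_assoc, ← mul_assoc _ (retraction Γ S y), ← this.eq,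
      mul_assoc]
  | inv x _ hx =>
    have := commute_of_mem_perp (retraction_mem S x) (retraction_mem (perp Γ S) x)
    conv_lhs => rw [hx]
    rw [map_inv, map_inv, this.eq, mul_inv_rev]

/-- The cosets of the link of a vertex. -/
abbrev LinkCoset (Γ : SimpleGraph V) (v : V) := RAAG Γ ⧸ parabolic Γ (Γ.neighborSet v)

/-- The semidirect product attached to the splitting of a right-angled Artin group as an HNN
extension with stable letter `v`. -/
abbrev Splitting (Γ : SimpleGraph V) (v : V) :=
  FreeGroup (LinkCoset Γ v) ⋊[permAut (RAAG Γ) (LinkCoset Γ v)] RAAG Γ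

open Classical in
/-- The embedding of a right-angled Artin group into a semidirect product acting on a tree. -/
noncomputable def toSplitting (Γ : SimpleGraph V) (v : V) : RAAG Γ →* Splitting Γ v :=
  lift (fun u => if u = v then
      SemidirectProduct.inl (FreeGroup.of ((1 : RAAG Γ) : LinkCoset Γ v))
    else SemidirectProduct.inr (gen Γ u)) <| by
    have key (u : V) (h : Γ.Adj v u) :
        Commute (SemidirectProduct.inl (FreeGroup.of ((1 : RAAG Γ) : LinkCoset Γ v)) :
          Splitting Γ v) (SemidirectProduct.inr (gen Γ u)) := by
      have h1 : gen Γ u • ((1 : RAAG Γ) : LinkCoset Γ v) = ((1 : RAAG Γ) : LinkCoset Γ v) := by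
        rw [MulAction.Quotient.smul_coe, eq_comm, QuotientGroup.eq]
        simpa using gen_mem_parabolic (Γ := Γ) (S := Γ.neighborSet v) h
      ext <;> simp [h1]
    intro u w h
    split_ifs with h1 h2 h2
    · exact absurd (h1.trans h2.symm) h.ne
    · exact key w (h1 ▸ h)
    · exact (key u (h2 ▸ h.symm)).symm
    · exact (commute_gen h).map _

theorem toSplitting_of_mem {S : Set V} {v : V} (hv : v ∉ S) {x : RAAG Γ}
    (hx : x ∈ parabolic Γ S) : toSplitting Γ v x = SemidirectProduct.inr x := by
  have : parabolic Γ S ≤ (toSplitting Γ v).eqLocus SemidirectProduct.inr := by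
    refine parabolic_le fun u hu => ?_
    have : u ≠ v := fun h => hv (h ▸ hu)
    change toSplitting Γ v (gen Γ u) = _
    simp [toSplitting, this]
  exact this hx

theorem toSplitting_right (v : V) (x : RAAG Γ) :
    (toSplitting Γ v x).right = retraction Γ {v}ᶜ x := by
  refine DFunLike.congr_fun (f := SemidirectProduct.rightHom.comp (toSplitting Γ v))
    (hom_ext fun u => ?_) x
  by_cases h : u = v
  · subst h
    simp [toSplitting, retraction]
  · simp [toSplitting, retraction, h]

/-- The conjugate of a stable letter attached to a coset of its link. -/
noncomputable def stableLetter (Γ : SimpleGraph V) (v : V) : LinkCoset Γ v → RAAG Γ :=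
  Quotient.lift (fun a => retraction Γ {v}ᶜ a * gen Γ v * (retraction Γ {v}ᶜ a)⁻¹) <| by
    intro a b hab
    have hab : a⁻¹ * b ∈ parabolic Γ (Γ.neighborSet v) := QuotientGroup.leftRel_apply.1 hab
    have h1 : a⁻¹ * b ∈ parabolic Γ {v}ᶜ :=
      parabolic_mono (fun u hu => by rintro rfl; exact Γ.loopless.irrefl _ hu) hab
    have h2 : Commute (gen Γ v) (a⁻¹ * b) := by
      refine commute_of_mem_perp (gen_mem_parabolic (Set.mem_singleton v)) ?_
      refine parabolic_mono (fun u hu => ?_) hab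
      rintro _ rfl
      exact hu
    obtain ⟨c, rfl⟩ : ∃ c, b = a * c := ⟨a⁻¹ * b, by simp⟩
    rw [inv_mul_cancel_left] at h1 h2
    simp only [map_mul, mem_parabolic_iff.1 h1, mul_inv_rev]
    rw [mul_assoc _ c, ← h2.eq]
    simp [mul_assoc]

theorem stableLetter_coe (v : V) (a : RAAG Γ) : stableLetter Γ v (a : LinkCoset Γ v) =
    retraction Γ {v}ᶜ a * gen Γ v * (retraction Γ {v}ᶜ a)⁻¹ := rfl

/-- The left inverse of `toSplitting`. -/
noncomputable def ofSplitting (Γ : SimpleGraph V) (v : V) : Splitting Γ v →* RAAG Γ :=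
  SemidirectProduct.lift (FreeGroup.lift (stableLetter Γ v)) (retraction Γ {v}ᶜ) fun g => by
    ext x
    obtain ⟨a, rfl⟩ := QuotientGroup.mk_surjective x
    simp [stableLetter_coe, mul_assoc]

theorem ofSplitting_toSplitting (v : V) (x : RAAG Γ) :
    ofSplitting Γ v (toSplitting Γ v x) = x := by
  refine DFunLike.congr_fun (f := (ofSplitting Γ v).comp (toSplitting Γ v))
    (g := MonoidHom.id _) (hom_ext fun u => ?_) x
  by_cases h : u = v
  · subst h
    simp [toSplitting, ofSplitting, stableLetter_coe]
  · simp [toSplitting, ofSplitting, h, retraction]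

theorem eq_lift_mul_retraction (v : V) (x : RAAG Γ) :
    x = FreeGroup.lift (stableLetter Γ v) (toSplitting Γ v x).left * retraction Γ {v}ᶜ x := by
  conv_lhs => rw [← ofSplitting_toSplitting v x, ← SemidirectProduct.inl_left_mul_inr_right
    (toSplitting Γ v x), toSplitting_right]
  rw [map_mul, ofSplitting, SemidirectProduct.lift_inl, SemidirectProduct.lift_inr,
    retraction_retraction, Set.inter_self]

/-- An element is full in a parabolic subgroup if it lies in it and all parabolic subgroups
containing a conjugate of it are at least as large. -/
def IsFull (S : Set V) (z : RAAG Γ) : Prop :=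
  z ∈ parabolic Γ S ∧ ∀ (a : RAAG Γ) (T : Set V), a * z * a⁻¹ ∈ parabolic Γ T → S ⊆ T

theorem retraction_commutator (S : Set V) (x y : RAAG Γ) :
    retraction Γ S ⁅x, y⁆ = ⁅retraction Γ S x, retraction Γ S y⁆ :=
  map_commutatorElement _ _ _

theorem exists_isFull [Finite V] (z : RAAG Γ) : ∃ a S, IsFull S (a * z * a⁻¹) := by
  have hne : ∃ n S, Set.ncard S = n ∧ ∃ a, a * z * a⁻¹ ∈ parabolic Γ S :=
    ⟨_, Set.univ, rfl, 1, by simp [parabolic_univ]⟩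
  classical
  obtain ⟨S, hS, a, ha⟩ := Nat.find_spec hne
  refine ⟨a, S, ha, fun b T hb => ?_⟩
  have h1 := retraction_mem_inter T ha
  have h2 : retraction Γ T b * retraction Γ T (a * z * a⁻¹) * (retraction Γ T b)⁻¹ =
      b * (a * z * a⁻¹) * b⁻¹ := by
    conv_rhs => rw [← mem_parabolic_iff.1 hb]
    simp only [map_mul, map_inv]
  have h3 : ((retraction Γ T b)⁻¹ * b * a) * z * ((retraction Γ T b)⁻¹ * b * a)⁻¹ ∈
      parabolic Γ (T ∩ S) := by
    convert h1 using 1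
    rw [mul_inv_eq_iff_eq_mul, ← eq_inv_mul_iff_mul_eq] at h2
    rw [h2]
    group
  have h4 := Nat.find_min' hne ⟨T ∩ S, rfl, _, h3⟩
  rw [← hS] at h4
  exact Set.inter_eq_right.1 (Set.eq_of_subset_of_ncard_le Set.inter_subset_right h4)

theorem IsFull.conj {S : Set V} {z : RAAG Γ} (hz : IsFull S z) {a : RAAG Γ}
    (ha : a ∈ parabolic Γ S) : IsFull S (a * z * a⁻¹) := by
  refine ⟨mul_mem (mul_mem ha hz.1) (inv_mem ha), fun b T hb => hz.2 (b * a) T ?_⟩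
  convert hb using 1
  group

/-- A full element of a parabolic subgroup has its centralizer in the join of the parabolic
subgroup with its orthogonal complement. -/
theorem IsFull.mem_sup_of_commute [Finite V] {S : Set V} {z c : RAAG Γ} (hz : IsFull S z)
    (hc : Commute c z) : c ∈ parabolic Γ S ⊔ parabolic Γ (perp Γ S) := by
  suffices h : ∀ R : Set V, R.Finite → ∀ c ∈ parabolic Γ (S ∪ R), Commute c z →
      c ∈ parabolic Γ S ⊔ parabolic Γ (perp Γ S) from
    h Set.univ Set.finite_univ c (by simp [parabolic_univ]) hc
  intro R hR
  induction R, hR using Set.Finite.induction_on with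
  | empty =>
    intro c hc _
    rw [Set.union_empty] at hc
    exact le_sup_left (a := parabolic Γ S) hc
  | @insert v R _ _ ih =>
    rw [Set.union_insert]
    by_cases hvR : v ∈ S ∪ R
    · rwa [Set.insert_eq_of_mem hvR]
    intro c hcT hcz
    classical
    set T := S ∪ R with hT
    have hST : S ⊆ T := Set.subset_union_left
    have hvS : v ∉ S := fun h => hvR (hST h)
    have hTv : {v}ᶜ ∩ insert v T = T := by
      ext u
      simp only [Set.mem_inter_iff, Set.mem_compl_iff, Set.mem_singleton_iff, Set.mem_insert_iff]
      refine ⟨fun h => h.2.resolve_left h.1, fun h => ⟨?_, Or.inr h⟩⟩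
      rintro rfl
      exact hvR h
    have hzv : retraction Γ {v}ᶜ z = z :=
      mem_parabolic_iff.1 (parabolic_mono (Set.subset_compl_singleton_iff.2 hvS) hz.1)
    have hzT : retraction Γ T z = z := mem_parabolic_iff.1 (parabolic_mono hST hz.1)
    have hgT : retraction Γ {v}ᶜ c ∈ parabolic Γ T := hTv ▸ retraction_mem_inter {v}ᶜ hcT
    have hg := ih _ hgT (by simpa only [hzv] using hcz.map (retraction Γ {v}ᶜ))
    set g := retraction Γ {v}ᶜ c
    set f := (toSplitting Γ v c).left with hf
    have hfc : FreeGroup.lift (stableLetter Γ v) f * g = c := (eq_lift_mul_retraction v c).symm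
    have hfz : FreeGroup.map (fun x : LinkCoset Γ v => z • x) f = f := by
      have h1 := congrArg SemidirectProduct.left (hcz.map (toSplitting Γ v)).eq
      rw [toSplitting_of_mem hvS hz.1] at h1
      simpa [permAut_apply] using h1.symm
    have hfcl := FreeGroup.mem_closure_of_map_eq (MulAction.injective z) hfz
    have hfT : FreeGroup.lift (stableLetter Γ v) f ∈ parabolic Γ (insert v T) := by
      rw [← eq_mul_inv_iff_mul_eq] at hfc
      rw [hfc]
      exact mul_mem hcT (inv_mem (parabolic_mono (Set.subset_insert _ _) hgT))
    rw [← hfc]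
    refine mul_mem ?_ hg
    rw [← mem_parabolic_iff.1 hfT]
    suffices h : Subgroup.closure (FreeGroup.of '' {x : LinkCoset Γ v | z • x = x}) ≤
        (parabolic Γ S ⊔ parabolic Γ (perp Γ S)).comap
          ((retraction Γ (insert v T)).comp (FreeGroup.lift (stableLetter Γ v))) from h hfcl
    rw [Subgroup.closure_le]
    rintro _ ⟨x, hx, rfl⟩
    obtain ⟨a, rfl⟩ := QuotientGroup.mk_surjective x
    have ha : a⁻¹ * z * a ∈ parabolic Γ (Γ.neighborSet v) := by
      have hx : ((z • a : RAAG Γ) : LinkCoset Γ v) = a := hx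
      rw [eq_comm, QuotientGroup.eq] at hx
      rwa [mul_assoc]
    set b := retraction Γ T a with hb
    have hbz : b⁻¹ * z * b ∈ parabolic Γ (Γ.neighborSet v) := by
      have h1 := parabolic_mono Set.inter_subset_right (retraction_mem_inter T ha)
      simpa only [map_mul, map_inv, hzT] using h1
    have hSv : S ⊆ Γ.neighborSet v := hz.2 b⁻¹ _ (by rwa [inv_inv])
    have hv : gen Γ v ∈ parabolic Γ (perp Γ S) :=
      gen_mem_parabolic fun u hu => (hSv hu : Γ.Adj v u).symm
    set e := retraction Γ (Γ.neighborSet v) b with he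
    have hez : e⁻¹ * z * e = b⁻¹ * z * b := by
      have hzn := mem_parabolic_iff.1 (parabolic_mono hSv hz.1)
      simpa only [map_mul, map_inv, hzn] using mem_parabolic_iff.1 hbz
    have hev : Commute e (gen Γ v) := by
      refine (commute_of_mem_perp (gen_mem_parabolic (Set.mem_singleton v))
        (parabolic_mono ?_ (retraction_mem (Γ.neighborSet v) b))).symm
      rintro u hu _ rfl
      exact hu
    have hbT : b ∈ parabolic Γ T := retraction_mem _ _
    have heT : e ∈ parabolic Γ T :=
      parabolic_mono Set.inter_subset_right (retraction_mem_inter _ hbT)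
    have hbe : b * e⁻¹ ∈ parabolic Γ S ⊔ parabolic Γ (perp Γ S) := by
      refine ih _ (mul_mem hbT (inv_mem heT)) ?_
      have h1 : z = e * (b⁻¹ * z * b) * e⁻¹ := by
        rw [← hez]
        group
      rw [commute_iff_eq]
      conv_lhs => rw [h1]
      group
    have hconj : retraction Γ (insert v T) (FreeGroup.lift (stableLetter Γ v)
        (FreeGroup.of (a : LinkCoset Γ v))) = (b * e⁻¹) * gen Γ v * (b * e⁻¹)⁻¹ := by
      rw [FreeGroup.lift_apply_of, stableLetter_coe, map_mul, map_mul, map_inv,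
        retraction_retraction, Set.inter_comm, hTv, retraction_gen (Set.mem_insert _ _), ← hb,
        mul_assoc b e⁻¹, hev.inv_left.eq]
      group
    change retraction Γ (insert v T) (FreeGroup.lift (stableLetter Γ v)
        (FreeGroup.of (a : LinkCoset Γ v))) ∈ parabolic Γ S ⊔ parabolic Γ (perp Γ S)
    rw [hconj]
    exact mul_mem (mul_mem hbe (le_sup_right (a := parabolic Γ S) hv)) (inv_mem hbe)

theorem exists_conj_mem_of_smul_eq {v : V} {z : RAAG Γ} {p : FreeGroup (LinkCoset Γ v)}
    (h : toSplitting Γ v z • p = p) : ∃ a, a * z * a⁻¹ ∈ parabolic Γ {v}ᶜ := by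
  have h1 := congrArg (ofSplitting Γ v) (eq_conj_inr_of_smul_eq h)
  rw [ofSplitting_toSplitting, map_mul, map_mul, map_inv] at h1
  refine ⟨(ofSplitting Γ v (SemidirectProduct.inl p))⁻¹, ?_⟩
  have h2 : ofSplitting Γ v (SemidirectProduct.inr (toSplitting Γ v z).right) ∈
      parabolic Γ {v}ᶜ := by
    rw [ofSplitting, SemidirectProduct.lift_inr]
    exact retraction_mem _ _
  convert h2 using 1
  rw [← eq_mul_inv_iff_mul_eq, inv_mul_eq_iff_eq_mul, inv_inv, ← mul_assoc]
  exact h1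

/-- Components of full elements in direct products of parabolic subgroups are full. -/
theorem IsFull.retraction_of_mem_sup {S T : Set V} {z : RAAG Γ} (hz : IsFull S z)
    (hTS : T ⊆ S) (h : z ∈ parabolic Γ T ⊔ parabolic Γ (perp Γ T)) :
    IsFull T (retraction Γ T z) := by
  refine ⟨retraction_mem _ _, fun a W ha => ?_⟩
  have h1 := retraction_mem_inter T ha
  rw [map_mul, map_mul, map_inv, retraction_retraction, Set.inter_self] at h1
  have hcomm := (commute_of_mem_perp (retraction_mem T a) (retraction_mem (perp Γ T) z))
  have h2 : retraction Γ T a * z * (retraction Γ T a)⁻¹ ∈ parabolic Γ (W ∪ perp Γ T) := by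
    have h3 : retraction Γ T a * z * (retraction Γ T a)⁻¹ = retraction Γ T a * retraction Γ T z *
        (retraction Γ T a)⁻¹ * retraction Γ (perp Γ T) z := by
      conv_lhs => rw [eq_mul_of_mem_sup h]
      simp only [mul_assoc, hcomm.inv_left.eq]
    rw [h3]
    exact mul_mem (parabolic_mono (Set.inter_subset_right.trans Set.subset_union_left) h1)
      (parabolic_mono Set.subset_union_right (retraction_mem _ _))
  intro u hu
  exact (hz.2 _ _ h2 (hTS hu)).resolve_right (notMem_perp hu)

/-- The centralizer of a full element of a parabolic subgroup inside this subgroup is abelian. -/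
theorem IsFull.commute_of_commute [Finite V] {S : Set V} {z x y : RAAG Γ} (hz : IsFull S z)
    (hx : x ∈ parabolic Γ S) (hy : y ∈ parabolic Γ S) (hxz : Commute x z) (hyz : Commute y z) :
    Commute x y := by
  induction hn : S.ncard using Nat.strong_induction_on generalizing S z x y with
  | _ n ih =>
  rw [← commutatorElement_eq_one_iff_commute]
  by_contra hne
  have hu : ⁅x, y⁆ ∈ parabolic Γ S :=
    mul_mem (mul_mem (mul_mem hx hy) (inv_mem hx)) (inv_mem hy)
  obtain ⟨v, hv⟩ : S.Nonempty := by
    rw [Set.nonempty_iff_ne_empty]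
    rintro rfl
    rw [parabolic_empty, Subgroup.mem_bot] at hu
    exact hne hu
  obtain ⟨p, hp⟩ := exists_mul_smul_eq_of_commute (x := toSplitting Γ v x)
    (y := toSplitting Γ v y) (z := toSplitting Γ v z) (fun p hp => by
      obtain ⟨a, ha⟩ := exists_conj_mem_of_smul_eq hp
      exact hz.2 a _ ha hv rfl) (hxz.map _) (hyz.map _)
  have hfix : toSplitting Γ v ⁅x, y⁆ • (toSplitting Γ v y * toSplitting Γ v x) • p =
      (toSplitting Γ v y * toSplitting Γ v x) • p := by
    rw [smul_smul, ← hp]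
    congr 1
    simp [commutatorElement_def, mul_assoc]
  obtain ⟨c, hc⟩ := exists_conj_mem_of_smul_eq hfix
  obtain ⟨a, T, haT⟩ := exists_isFull ⁅x, y⁆
  have hTS : T ⊆ S := haT.2 a⁻¹ S (by convert hu using 1; group)
  have hTv : T ⊆ {v}ᶜ := haT.2 (c * a⁻¹) _ (by convert hc using 1; group)
  have hTn : T.ncard < n := by
    rw [← hn]
    exact Set.ncard_lt_ncard ⟨hTS, fun h => hTv (h hv) rfl⟩
  set b := retraction Γ S a with hb
  have hbS : b ∈ parabolic Γ S := retraction_mem _ _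
  have hbu : a * ⁅x, y⁆ * a⁻¹ = b * ⁅x, y⁆ * b⁻¹ := by
    rw [← mem_parabolic_iff.1 (parabolic_mono hTS haT.1), map_mul, map_mul, map_inv,
      mem_parabolic_iff.1 hu]
  rw [hbu] at haT
  have conj {x : RAAG Γ} (hx : Commute x z) : Commute (b * x * b⁻¹) (b * z * b⁻¹) :=
    hx.map (MulAut.conj b)
  have hzT := haT.mem_sup_of_commute (c := b * z * b⁻¹) (conj
    (((hxz.mul_left hyz).mul_left hxz.inv_left).mul_left hyz.inv_left)).symm
  have hcomm := ih _ hTn ((hz.conj hbS).retraction_of_mem_sup hTS hzT) (retraction_mem _ _)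
    (retraction_mem _ _) ((conj hxz).map (retraction Γ T)) ((conj hyz).map (retraction Γ T)) rfl
  rw [← commutatorElement_eq_one_iff_commute, ← retraction_commutator,
    ← conjugate_commutatorElement, mem_parabolic_iff.1 haT.1] at hcomm
  exact hne (by simpa using hcomm)

/-- Commutators of elements centralizing a full element of `parabolic Γ S` lie in
`parabolic Γ (perp Γ S)`. -/
theorem IsFull.retraction_perp_commutator [Finite V] {S : Set V} {z c d : RAAG Γ}
    (hz : IsFull S z) (hc : Commute c z) (hd : Commute d z) :
    retraction Γ (perp Γ S) ⁅c, d⁆ = ⁅c, d⁆ := by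
  have hu := hz.mem_sup_of_commute
    (((hc.mul_left hd).mul_left hc.inv_left).mul_left hd.inv_left)
  have hzS := mem_parabolic_iff.1 hz.1
  have h1 : retraction Γ S ⁅c, d⁆ = 1 := by
    rw [retraction_commutator, commutatorElement_eq_one_iff_commute]
    exact hz.commute_of_commute (retraction_mem _ _) (retraction_mem _ _)
      (by simpa only [hzS] using hc.map (retraction Γ S))
      (by simpa only [hzS] using hd.map (retraction Γ S))
  have h2 := eq_mul_of_mem_sup hu
  rw [← commutatorElement_def, h1, one_mul] at h2
  exact h2.symm

section Quotient

variable {L C : Type*} [Group L] [Group C] {i : L →* C} {r : C →* L} {φ : C →* RAAG Γ}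

theorem mem_center_of_map_eq_one (hri : ∀ l, r (i l) = l)
    (hφ : ∀ (c : C) (l : L), φ ⁅c, i l⁆ = 1 → ⁅c, i l⁆ = 1) {c : C} (hc : φ c = 1) :
    r c ∈ Subgroup.center L := by
  rw [Subgroup.mem_center_iff]
  intro l
  have h1 := congrArg r (hφ c l (by rw [map_commutatorElement, hc, commutatorElement_one_left]))
  rw [map_commutatorElement, hri, map_one, commutatorElement_eq_one_iff_mul_comm] at h1
  exact h1.symm

theorem exists_isVirtualRetract_of_forall_center (hri : ∀ l, r (i l) = l) {T : Set V}
    (hT : φ.range ≤ parabolic Γ T) (hind : φ.range.relIndex (parabolic Γ T) ≠ 0)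
    (hφ : ∀ (c : C) (l : L), φ ⁅c, i l⁆ = 1 → ⁅c, i l⁆ = 1)
    (hZ : ∀ l ∈ Subgroup.center L, φ (i l) = 1) :
    ∃ R : Subgroup (RAAG Γ), IsVirtualRetract R ∧ Nonempty ((L ⧸ Subgroup.center L) ≃* R) := by
  have hker : Subgroup.center L = (φ.comp i).ker := by
    refine le_antisymm (fun l hl => hZ l hl) fun l hl => ?_
    rw [← hri l]
    exact mem_center_of_map_eq_one hri hφ hl
  have hfix (l : L) : retraction Γ T (φ (i l)) = φ (i l) := mem_parabolic_iff.1 (hT ⟨_, rfl⟩)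
  refine ⟨(φ.comp i).range, ⟨φ.range.comap (retraction Γ T), ?_, ?_, ?_⟩,
    ⟨(QuotientGroup.quotientMulEquivOfEq hker).trans (QuotientGroup.quotientKerEquivRange _)⟩⟩
  · rintro _ ⟨l, rfl⟩
    exact ⟨i l, (hfix l).symm⟩
  · rwa [Subgroup.index_comap]
  · let ρ : φ.range.comap (retraction Γ T) →* φ.range :=
      ((retraction Γ T).comp (Subgroup.subtype _)).codRestrict φ.range fun x => x.2
    let θ : C →* (φ.comp i).range := (φ.comp i).rangeRestrict.comp r
    have hθ : φ.rangeRestrict.ker ≤ θ.ker := by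
      intro c hc
      rw [MonoidHom.ker_rangeRestrict] at hc
      exact Subtype.ext (hZ _ (mem_center_of_map_eq_one hri hφ hc))
    refine ⟨(φ.rangeRestrict.liftOfSurjective φ.rangeRestrict_surjective ⟨θ, hθ⟩).comp ρ, ?_⟩
    rintro ⟨_, l, rfl⟩
    have h1 : ρ ⟨φ (i l), ⟨i l, (hfix l).symm⟩⟩ = φ.rangeRestrict (i l) := Subtype.ext (hfix l)
    change φ.rangeRestrict.liftOfSurjective φ.rangeRestrict_surjective ⟨θ, hθ⟩
      (ρ ⟨φ (i l), _⟩) = _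
    rw [h1]
    refine (φ.rangeRestrict.liftOfRightInverse_comp_apply _ _ ⟨θ, hθ⟩ (i l)).trans ?_
    exact Subtype.ext (congrArg (fun l => φ (i l)) (hri l))

end Quotient

/-- If `L` is a retract of a group `C` that maps virtually onto a parabolic subgroup, and the map
detects commutators with `L`, then `L` modulo its center is a virtual retract. -/
theorem exists_isVirtualRetract [Finite V] {L C : Type*} [Group L] [Group C] {i : L →* C}
    {r : C →* L} {φ : C →* RAAG Γ} (hri : ∀ l, r (i l) = l) {T : Set V}
    (hT : φ.range ≤ parabolic Γ T) (hind : φ.range.relIndex (parabolic Γ T) ≠ 0)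
    (hφ : ∀ (c : C) (l : L), φ ⁅c, i l⁆ = 1 → ⁅c, i l⁆ = 1) :
    ∃ R : Subgroup (RAAG Γ), IsVirtualRetract R ∧ Nonempty ((L ⧸ Subgroup.center L) ≃* R) := by
  by_cases hZ : ∀ l ∈ Subgroup.center L, φ (i l) = 1
  · exact exists_isVirtualRetract_of_forall_center hri hT hind hφ hZ
  push Not at hZ
  obtain ⟨l₀, hl₀, hne⟩ := hZ
  set z := φ (i l₀) with hz
  have hzT : z ∈ parabolic Γ T := hT ⟨_, rfl⟩
  obtain ⟨a, S, ha, hS⟩ : ∃ a S, a ∈ parabolic Γ T ∧ IsFull S (a * z * a⁻¹) := by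
    obtain ⟨a, S, hS⟩ := exists_isFull z
    have hST : S ⊆ T := hS.2 a⁻¹ T (by convert hzT using 1; group)
    refine ⟨retraction Γ T a, S, retraction_mem _ _, ?_⟩
    rwa [← mem_parabolic_iff.1 (parabolic_mono hST hS.1), map_mul, map_mul, map_inv,
      mem_parabolic_iff.1 hzT] at hS
  have hST : S ⊆ T := hS.2 1 T (by
    simpa using mul_mem (mul_mem ha hzT) (inv_mem ha))
  obtain ⟨u, hu⟩ : S.Nonempty := by
    rw [Set.nonempty_iff_ne_empty]
    rintro rfl
    have h1 := hS.1
    rw [parabolic_empty, Subgroup.mem_bot] at h1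
    exact hne (by simpa using h1)
  let conj : RAAG Γ →* RAAG Γ := (MulAut.conj a).toMonoidHom
  let C' : Subgroup C := (Subgroup.centralizer {z}).comap φ
  have hC' (c : C') : Commute (conj (φ c)) (a * z * a⁻¹) := by
    have h1 : Commute (φ c) z := Subgroup.mem_centralizer_singleton_iff.1 c.2
    exact h1.map conj
  have hi (l : L) : i l ∈ C' := by
    refine Subgroup.mem_centralizer_singleton_iff.2 ?_
    rw [hz, ← map_mul, ← map_mul, ← map_mul, ← map_mul, Subgroup.mem_center_iff.1 hl₀ l]
  let φ' : C' →* RAAG Γ := (retraction Γ (perp Γ S)).comp ((conj.comp φ).comp C'.subtype)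
  have hconj (c : C) : conj (φ c) ∈ parabolic Γ T := mul_mem (mul_mem ha (hT ⟨c, rfl⟩)) (inv_mem ha)
  have hlt : (perp Γ S ∩ T).ncard < T.ncard :=
    Set.ncard_lt_ncard ⟨Set.inter_subset_right, fun h => notMem_perp hu (h (hST hu)).1⟩
  refine exists_isVirtualRetract (i := i.codRestrict C' hi) (r := r.comp C'.subtype) (φ := φ')
    (T := perp Γ S ∩ T) hri ?_ ?_ ?_
  · rintro _ ⟨c, rfl⟩
    exact retraction_mem_inter _ (hconj c)
  · have h1 : (φ.range.map conj).relIndex ((parabolic Γ T).map conj) ≠ 0 := by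
      rwa [Subgroup.relIndex_map_map_of_injective _ _ (MulAut.conj a).injective]
    have h2 : parabolic Γ (perp Γ S ∩ T) ≤ (parabolic Γ T).map conj := by
      intro x hx
      refine ⟨a⁻¹ * x * a, mul_mem (mul_mem (inv_mem ha)
        (parabolic_mono Set.inter_subset_right hx)) ha, ?_⟩
      change a * (a⁻¹ * x * a) * a⁻¹ = x
      group
    have h3 : φ.range.map conj ⊓ parabolic Γ (perp Γ S ∩ T) ≤ φ'.range := by
      rintro _ ⟨⟨_, ⟨c, rfl⟩, rfl⟩, hx⟩
      have hx' : conj (φ c) ∈ parabolic Γ (perp Γ S) := parabolic_mono Set.inter_subset_left hx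
      have hc : c ∈ C' := by
        refine Subgroup.mem_centralizer_singleton_iff.2 ((MulAut.conj a).injective ?_)
        rw [map_mul, map_mul]
        exact (commute_of_mem_perp hS.1 hx').symm.eq
      exact ⟨⟨c, hc⟩, mem_parabolic_iff.1 hx'⟩
    refine mt (Subgroup.relIndex_eq_zero_of_le_left h3) ?_
    rw [Subgroup.inf_relIndex_right]
    exact mt (Subgroup.relIndex_eq_zero_of_le_right h2) h1
  · intro c l hcl
    refine Subtype.ext (hφ c l ?_)
    have h1 := hS.retraction_perp_commutator (hC' c) (hC' ⟨i l, hi l⟩)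
    rw [← map_commutatorElement, ← map_commutatorElement] at h1
    exact (MulAut.conj a).injective ((h1.symm.trans hcl).trans (map_one _).symm)
termination_by T.ncard

/-- A bijection of vertices induces an isomorphism of right-angled Artin groups. -/
def congrComap {W : Type*} (Γ : SimpleGraph V) (e : W ≃ V) : RAAG Γ ≃* RAAG (Γ.comap e) :=
  MonoidHom.toMulEquiv
    (lift (fun v => gen (Γ.comap e) (e.symm v)) fun u v h => commute_gen (by simpa using h))
    (lift (fun w => gen Γ (e w)) fun u v h => commute_gen h)
    (hom_ext fun v => by simp) (hom_ext fun w => by simp)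

end RAAG

/-- If `H` is a virtual retract of a finitely generated right-angled Artin group and
`Z` is the center of `H`, then `H / Z` is again (isomorphic to) a virtual retract of a
finitely generated right-angled Artin group. -/
theorem quotient_by_center_of_virtual_retract_is_VR
    {V : Type*} [Fintype V] (Γ : SimpleGraph V)
    (H : Subgroup (RAAG Γ)) (hH : IsVirtualRetract H) :
    ∃ (V' : Type) (_ : Fintype V') (Γ' : SimpleGraph V') (R : Subgroup (RAAG Γ')),
      IsVirtualRetract R ∧ Nonempty ((H ⧸ Subgroup.center H) ≃* R) := by
  obtain ⟨K, hK, hind, r, hr⟩ := hH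
  let e := RAAG.congrComap Γ (Fintype.equivFin V).symm
  let φ : K →* RAAG (Γ.comap (Fintype.equivFin V).symm) := e.toMonoidHom.comp K.subtype
  have hφ : Function.Injective φ := e.injective.comp K.subtype_injective
  have hrange : φ.range = K.map e.toMonoidHom := by
    rw [MonoidHom.range_comp, Subgroup.range_subtype]
  refine ⟨_, inferInstance, _, RAAG.exists_isVirtualRetract (i := Subgroup.inclusion hK) (r := r)
    (φ := φ) (T := Set.univ) hr ?_ ?_ fun c l h => hφ (h.trans (map_one φ).symm)⟩
  · rw [RAAG.parabolic_univ]
    exact le_top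
  · rw [RAAG.parabolic_univ, Subgroup.relIndex_top_right, hrange]
    exact (Subgroup.index_map_of_bijective (f := e.toMonoidHom) e.bijective K).trans_ne hind
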